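/- Fix 2 ≤ r ≤ n. Let Δ be an n-dimensional convex body in ℝ^n such that the Bezout inequality V(K_1,…,K_r,Δ[n−r])·V_n(Δ)^{r−1} ≤ ∏_{i=1}^r V(K_i,Δ[n−1]) holds for all convex bodies K_1,…,K_r in ℝ^n. Then the boundary of Δ does not contain any strict points. -/

import Mathlib

open Pointwise MeasureTheory

/-- The mixed volume of an `n`-tuple of sets in `ℝⁿ`, via the polarization formula. -/
noncomputable def mixedVol (n : ℕ) (K : Fin n → Set (EuclideanSpace ℝ (Fin n))) : ℝ :=
  ((n.factorial : ℝ))⁻¹ *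
    ∑ S : Finset (Fin n), (-1 : ℝ) ^ (n - S.card) * (volume (∑ i ∈ S, K i)).toReal

/-- A convex body: a nonempty compact convex set. -/
def IsConvexBody {n : ℕ} (K : Set (EuclideanSpace ℝ (Fin n))) : Prop :=
  Convex ℝ K ∧ IsCompact K ∧ K.Nonempty

/-- A boundary point `x` of `K` is a strict point if it does not belong to any
(nondegenerate) line segment contained in the boundary of `K`. -/
def IsStrictPoint {n : ℕ} (K : Set (EuclideanSpace ℝ (Fin n)))
    (x : EuclideanSpace ℝ (Fin n)) : Prop :=
  x ∈ frontier K ∧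
    ∀ a b : EuclideanSpace ℝ (Fin n), segment ℝ a b ⊆ frontier K → x ∈ segment ℝ a b → a = b

/-- Polarization: the alternating sum of the `k`-th powers of the partial sums of `a` over `T`
vanishes for `k < #T` and equals `(#T)! ∏ a` for `k = #T`. -/
lemma sum_powerset_neg_one_pow_mul_add_sum_pow {ι : Type*} [DecidableEq ι] (a : ι → ℝ)
    (T : Finset ι) : ∀ k ≤ T.card, ∀ b : ℝ,
    ∑ S ∈ T.powerset, (-1 : ℝ) ^ (T.card - S.card) * (b + ∑ i ∈ S, a i) ^ k =
      if k = T.card then (T.card.factorial : ℝ) * ∏ i ∈ T, a i else 0 := by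
  induction T using Finset.induction_on with
  | empty =>
    intro k hk b
    obtain rfl : k = 0 := by simpa using hk
    simp
  | insert i T hi ih =>
    intro k hk b
    rw [Finset.card_insert_of_notMem hi] at hk ⊢
    rw [Finset.sum_powerset_insert hi, ← Finset.sum_add_distrib]
    have expand : ∀ x : ℝ, (x + a i) ^ k - x ^ k =
        ∑ m ∈ Finset.range k, (a i) ^ (k - m) * (k.choose m) * x ^ m := by
      intro x
      rw [add_pow, Finset.sum_range_succ]
      simp only [tsub_self, pow_zero, Nat.choose_self, Nat.cast_one, mul_one, add_sub_cancel_right]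
      exact Finset.sum_congr rfl fun m _ => by ring
    have key : ∀ S ∈ T.powerset,
        (-1 : ℝ) ^ (T.card + 1 - S.card) * (b + ∑ j ∈ S, a j) ^ k +
          (-1 : ℝ) ^ (T.card + 1 - (insert i S).card) * (b + ∑ j ∈ insert i S, a j) ^ k =
        ∑ m ∈ Finset.range k, (a i) ^ (k - m) * (k.choose m) *
          ((-1 : ℝ) ^ (T.card - S.card) * (b + ∑ j ∈ S, a j) ^ m) := by
      intro S hS
      rw [Finset.mem_powerset] at hS
      have hiS : i ∉ S := fun h => hi (hS h)
      have hc : S.card ≤ T.card := Finset.card_le_card hS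
      rw [Finset.card_insert_of_notMem hiS, Finset.sum_insert hiS, Nat.add_sub_add_right,
        Nat.succ_sub hc, pow_succ]
      have h1 := expand (b + ∑ j ∈ S, a j)
      have h2 : b + (a i + ∑ j ∈ S, a j) = b + ∑ j ∈ S, a j + a i := by ring
      rw [h2]
      calc _ = (-1 : ℝ) ^ (T.card - S.card) *
            ((b + ∑ j ∈ S, a j + a i) ^ k - (b + ∑ j ∈ S, a j) ^ k) := by ring
        _ = _ := by
          rw [h1, Finset.mul_sum]
          exact Finset.sum_congr rfl fun m _ => by ring
    rw [Finset.sum_congr rfl key, Finset.sum_comm]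
    simp_rw [← Finset.mul_sum]
    have h3 : ∀ m ∈ Finset.range k, (a i) ^ (k - m) * (k.choose m : ℝ) *
        ∑ S ∈ T.powerset, (-1 : ℝ) ^ (T.card - S.card) * (b + ∑ j ∈ S, a j) ^ m =
        (a i) ^ (k - m) * (k.choose m : ℝ) *
          (if m = T.card then (T.card.factorial : ℝ) * ∏ i ∈ T, a i else 0) := by
      intro m hm
      rw [Finset.mem_range] at hm
      rw [ih m (by omega) b]
    rw [Finset.sum_congr rfl h3]
    by_cases hkT : k = T.card + 1
    · subst hkT
      rw [Finset.sum_eq_single_of_mem T.card (by simp) (fun m _ hm => by simp [hm])]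
      simp [Finset.prod_insert hi, Nat.factorial_succ]
      ring
    · rw [if_neg hkT]
      refine Finset.sum_eq_zero fun m hm => ?_
      rw [Finset.mem_range] at hm
      rw [if_neg (by omega), mul_zero]

lemma sum_finset_fin_neg_one_pow_mul {n : ℕ} (i : Fin n) (φ : Finset (Fin n) → ℝ) :
    ∑ S : Finset (Fin n), (-1 : ℝ) ^ (n - S.card) * φ S =
      ∑ S ∈ (Finset.univ.erase i).powerset,
        (-1 : ℝ) ^ ((Finset.univ.erase i).card - S.card) * (φ (insert i S) - φ S) := by
  have hn : 0 < n := i.pos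
  have h : (Finset.univ : Finset (Finset (Fin n))) = (insert i (Finset.univ.erase i)).powerset := by
    rw [Finset.insert_erase (Finset.mem_univ i), Finset.powerset_univ]
  rw [h, Finset.sum_powerset_insert (Finset.notMem_erase i _), ← Finset.sum_add_distrib]
  refine Finset.sum_congr rfl fun S hS => ?_
  rw [Finset.mem_powerset] at hS
  have hiS : i ∉ S := fun h => Finset.notMem_erase i _ (hS h)
  have hc := Finset.card_le_card hS
  rw [Finset.card_insert_of_notMem hiS]
  rw [Finset.card_erase_of_mem (Finset.mem_univ i), Finset.card_univ, Fintype.card_fin] at hc ⊢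
  have h1 : n - S.card = (n - 1 - S.card) + 1 := by omega
  have h2 : n - (S.card + 1) = n - 1 - S.card := by omega
  rw [h1, h2, pow_succ]
  ring

/-- Fubini in a prescribed direction `u`. -/
lemma exists_equiv_volume_eq_lintegral_columns {k : ℕ} (u : EuclideanSpace ℝ (Fin (k + 1)))
    (hu : u ≠ 0) :
    ∃ (T : (ℝ × (Fin k → ℝ)) ≃L[ℝ] EuclideanSpace ℝ (Fin (k + 1))) (c : ENNReal),
      c ≠ 0 ∧ c ≠ ⊤ ∧ T (1, 0) = u ∧ ∀ A : Set (EuclideanSpace ℝ (Fin (k + 1))),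
        MeasurableSet A → volume A = c * ∫⁻ z, volume {t : ℝ | T (t, z) ∈ A} := by
  have hfr : Module.finrank ℝ (ℝ × (Fin k → ℝ)) =
      Module.finrank ℝ (EuclideanSpace ℝ (Fin (k + 1))) := by
    simp [Module.finrank_prod, add_comm]
  let e : (ℝ × (Fin k → ℝ)) ≃L[ℝ] EuclideanSpace ℝ (Fin (k + 1)) :=
    ContinuousLinearEquiv.ofFinrankEq hfr
  have he : e (1, 0) ≠ 0 := by simp
  obtain ⟨A, hA⟩ := SeparatingDual.exists_continuousLinearEquiv_apply_eq (R := ℝ) he hu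
  let T := e.trans A
  let μ : Measure (EuclideanSpace ℝ (Fin (k + 1))) :=
    ((volume : Measure ℝ).prod (volume : Measure (Fin k → ℝ))).map T
  have : μ.IsAddHaarMeasure := T.isAddHaarMeasure_map _
  have hμ := Measure.isAddLeftInvariant_eq_smul
    (volume : Measure (EuclideanSpace ℝ (Fin (k + 1)))) μ
  refine ⟨T, Measure.addHaarScalarFactor volume μ, ?_, by simp, hA, ?_⟩
  · have := Measure.addHaarScalarFactor_pos_of_isAddHaarMeasure
      (volume : Measure (EuclideanSpace ℝ (Fin (k + 1)))) μ
    exact_mod_cast this.ne'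
  · intro B hB
    conv_lhs => rw [hμ]
    rw [Measure.smul_apply, Measure.map_apply T.continuous.measurable hB,
      Measure.prod_apply_symm (T.continuous.measurable hB)]
    rfl

lemma IsConvexBody.add {n : ℕ} {A B : Set (EuclideanSpace ℝ (Fin n))} (hA : IsConvexBody A)
    (hB : IsConvexBody B) : IsConvexBody (A + B) :=
  ⟨hA.1.add hB.1, hA.2.1.add hB.2.1, hA.2.2.add hB.2.2⟩

lemma IsConvexBody.smul {n : ℕ} {A : Set (EuclideanSpace ℝ (Fin n))} (hA : IsConvexBody A)
    (c : ℝ) : IsConvexBody (c • A) :=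
  ⟨hA.1.smul c, hA.2.1.smul c, hA.2.2.smul_set⟩

/-- Adding a segment to a convex body increases its volume by a multiple of the volume of its
projection along the segment. -/
lemma volume_add_segment {k : ℕ} {u : EuclideanSpace ℝ (Fin (k + 1))}
    {T : (ℝ × (Fin k → ℝ)) ≃L[ℝ] EuclideanSpace ℝ (Fin (k + 1))} {c : ENNReal}
    (hT : T (1, 0) = u)
    (hvol : ∀ A : Set (EuclideanSpace ℝ (Fin (k + 1))),
        MeasurableSet A → volume A = c * ∫⁻ z, volume {t : ℝ | T (t, z) ∈ A})
    {L : Set (EuclideanSpace ℝ (Fin (k + 1)))} (hL : IsConvexBody L) :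
    volume (L + segment ℝ 0 u) =
      volume L + c * volume ((fun w => (T.symm w).2) '' L) := by
  have hTadd : ∀ (t s : ℝ) (z : Fin k → ℝ), T (t + s, z) = T (t, z) + s • u := by
    intro t s z
    rw [← hT, ← map_smul, ← map_add]
    simp
  have hI : IsCompact (segment ℝ 0 u) := by
    rw [segment_eq_image_lineMap]
    exact isCompact_Icc.image (AffineMap.lineMap_continuous)
  have hLI : IsCompact (L + segment ℝ 0 u) := hL.2.1.add hI
  have hP : IsCompact ((fun w => (T.symm w).2) '' L) :=
    hL.2.1.image (continuous_snd.comp T.symm.continuous)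
  have hcol : ∀ z, volume {t : ℝ | T (t, z) ∈ L + segment ℝ 0 u} =
      volume {t : ℝ | T (t, z) ∈ L} +
        ((fun w => (T.symm w).2) '' L).indicator (fun _ => (1 : ENNReal)) z := by
    intro z
    have hset : {t : ℝ | T (t, z) ∈ L + segment ℝ 0 u} =
        {t : ℝ | T (t, z) ∈ L} + Set.Icc (0 : ℝ) 1 := by
      ext t
      simp only [Set.mem_ofPred_eq, Set.mem_add]
      constructor
      · rintro ⟨y, hy, w, hw, hyw⟩
        rw [segment_eq_image'] at hw
        obtain ⟨s, hs, rfl⟩ := hw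
        refine ⟨t - s, ?_, s, hs, by ring⟩
        have := hTadd (t - s) s z
        rw [sub_add_cancel, ← hyw] at this
        simp only [sub_zero, zero_add, add_left_inj] at this
        rwa [← this]
      · rintro ⟨t', ht', s, hs, rfl⟩
        refine ⟨_, ht', s • u, ?_, (hTadd _ _ _).symm⟩
        rw [segment_eq_image']
        exact ⟨s, hs, by simp⟩
    rw [hset]
    by_cases hz : z ∈ (fun w => (T.symm w).2) '' L
    · rw [Set.indicator_of_mem hz]
      have hne : {t : ℝ | T (t, z) ∈ L}.Nonempty := by
        obtain ⟨w, hw, rfl⟩ := hz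
        exact ⟨(T.symm w).1, by simpa using hw⟩
      have hcont : Continuous fun t : ℝ => (t, z) := by fun_prop
      have hcomp : IsCompact {t : ℝ | T (t, z) ∈ L} := by
        have h1 : IsCompact (Prod.fst '' (T ⁻¹' L)) :=
          (T.toHomeomorph.isCompact_preimage.2 hL.2.1).image continuous_fst
        refine h1.of_isClosed_subset
          (hL.2.1.isClosed.preimage (T.continuous.comp hcont)) ?_
        intro t ht
        exact ⟨(t, z), ht, rfl⟩
      have hconv : Convex ℝ {t : ℝ | T (t, z) ∈ L} := by
        intro t ht s hs a b ha hb hab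
        have := hL.1 ht hs ha hb hab
        rw [← map_smul, ← map_smul, ← map_add] at this
        simp only [Set.mem_ofPred_eq]
        convert this using 2
        ext i <;> simp
        rw [← add_mul, hab, one_mul]
      have hIcc := eq_Icc_of_connected_compact ⟨hne, hconv.isPreconnected⟩ hcomp
      generalize sInf {t : ℝ | T (t, z) ∈ L} = a at hIcc
      generalize sSup {t : ℝ | T (t, z) ∈ L} = b at hIcc
      rw [hIcc] at hne ⊢
      have hab : a ≤ b := Set.nonempty_Icc.1 hne
      rw [Set.Icc_add_Icc hab zero_le_one, Real.volume_Icc, Real.volume_Icc,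
        ← ENNReal.ofReal_one, ← ENNReal.ofReal_add (by linarith) zero_le_one]
      congr 1
      ring
    · have hempty : {t : ℝ | T (t, z) ∈ L} = ∅ := by
        rw [Set.eq_empty_iff_forall_notMem]
        intro t ht
        exact hz ⟨T (t, z), ht, by simp⟩
      rw [Set.indicator_of_notMem hz, hempty]
      simp
  rw [hvol _ hLI.measurableSet, hvol _ hL.2.1.measurableSet, ← mul_add]
  simp_rw [hcol]
  rw [lintegral_add_right _ (measurable_const.indicator hP.measurableSet),
    lintegral_indicator hP.measurableSet]
  simp

/-- Near a strict point, boundary points of `Δ` lie uniformly beyond the part of `Δ` away from the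
strict point, measured in the directions of their outer normals. -/
lemma IsStrictPoint.exists_support_gap {n : ℕ} {Δ : Set (EuclideanSpace ℝ (Fin n))}
    (hΔ : IsConvexBody Δ) {x : EuclideanSpace ℝ (Fin n)} (hx : IsStrictPoint Δ x) {ρ : ℝ}
    (hρ : 0 < ρ) :
    ∃ δ > 0, ∀ v y q : EuclideanSpace ℝ (Fin n), ‖v‖ = 1 → y ∈ Δ →
      (∀ a ∈ Δ, inner ℝ v a ≤ inner ℝ v y) → dist y x ≤ δ → q ∈ Δ \ Metric.ball x ρ →
      inner ℝ v q + δ ≤ inner ℝ v y := by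
  have hxΔ : x ∈ Δ := hΔ.2.1.isClosed.frontier_subset hx.1
  let C : Set (EuclideanSpace ℝ (Fin n) × EuclideanSpace ℝ (Fin n) × EuclideanSpace ℝ (Fin n)) :=
    (Metric.sphere 0 1 ×ˢ (Δ ×ˢ (Δ \ Metric.ball x ρ))) ∩
      ⋂ a ∈ Δ, {w | inner ℝ w.1 a ≤ inner ℝ w.1 w.2.1}
  have hC : IsCompact C := by
    refine ((isCompact_sphere _ _).prod (hΔ.2.1.prod (hΔ.2.1.diff Metric.isOpen_ball))).inter_right
      (isClosed_biInter fun a _ => isClosed_le (by fun_prop) (by fun_prop))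
  rcases C.eq_empty_or_nonempty with hCe | hCne
  · refine ⟨1, one_pos, fun v y q hv hy hsup _ hq => ?_⟩
    have : (v, y, q) ∈ C := by
      refine ⟨⟨by simpa using hv, hy, hq⟩, ?_⟩
      simpa using hsup
    simp [hCe] at this
  · obtain ⟨⟨v₀, y₀, q₀⟩, hmem, hmin⟩ := hC.exists_isMinOn hCne
      (f := fun w => inner ℝ w.1 (w.2.1 - w.2.2) + dist w.2.1 x) (by fun_prop)
    obtain ⟨⟨hv₀, hy₀, hq₀⟩, hs₀⟩ := hmem
    simp only [Set.mem_iInter, Set.mem_ofPred_eq] at hs₀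
    have hpos : 0 < inner ℝ v₀ (y₀ - q₀) + dist y₀ x := by
      have h1 : 0 ≤ inner ℝ v₀ (y₀ - q₀) := by
        rw [inner_sub_right]; linarith [hs₀ q₀ hq₀.1]
      rcases eq_or_ne y₀ x with rfl | hne
      · rw [dist_self, add_zero]
        refine lt_of_le_of_ne h1 fun h0 => ?_
        rw [inner_sub_right] at h0
        have hseg : segment ℝ y₀ q₀ ⊆ frontier Δ := by
          intro w hw
          have hwΔ : w ∈ Δ := hΔ.1.segment_subset hxΔ hq₀.1 hw
          refine ⟨subset_closure hwΔ, fun h_int => ?_⟩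
          have hwv : inner ℝ v₀ w = inner ℝ v₀ y₀ := by
            obtain ⟨a, b, ha, hb, hab, rfl⟩ := hw
            rw [inner_add_right, inner_smul_right, inner_smul_right]
            have : inner ℝ v₀ q₀ = inner ℝ v₀ y₀ := by linarith
            rw [this, ← add_mul, hab, one_mul]
          have hcont : Continuous fun s : ℝ => w + s • v₀ := by fun_prop
          have hnhds : ∀ᶠ s : ℝ in nhds 0, w + s • v₀ ∈ Δ :=
            hcont.continuousAt.eventually_mem (by
              simpa using mem_interior_iff_mem_nhds.1 h_int)
          obtain ⟨s, hs, hs0⟩ :=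
            ((hnhds.filter_mono nhdsWithin_le_nhds).and
              (self_mem_nhdsWithin (s := Set.Ioi (0 : ℝ)))).exists
          have h2 := hs₀ _ hs
          rw [inner_add_right, inner_smul_right, real_inner_self_eq_norm_sq, hwv] at h2
          have hv1 : ‖v₀‖ = 1 := by simpa using hv₀
          rw [hv1] at h2
          replace hs0 : 0 < s := hs0
          linarith
        have := hx.2 y₀ q₀ hseg (left_mem_segment ℝ y₀ q₀)
        exact hq₀.2 (by rw [← this]; exact Metric.mem_ball_self hρ)
      · have := dist_pos.2 hne
        linarith
    refine ⟨(inner ℝ v₀ (y₀ - q₀) + dist y₀ x) / 2, by positivity, ?_⟩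
    intro v y q hv hy hsup hd hq
    have hm : (v, y, q) ∈ C := by
      refine ⟨⟨by simpa using hv, hy, hq⟩, ?_⟩
      simpa using hsup
    have := hmin hm
    rw [Set.mem_ofPred_eq] at this
    simp only [inner_sub_right v] at this
    linarith

/-- A boundary point of a convex body has a unit outer normal. -/
lemma IsConvexBody.exists_unit_normal {n : ℕ} {Δ : Set (EuclideanSpace ℝ (Fin n))}
    (hΔ : IsConvexBody Δ) (hdim : (interior Δ).Nonempty) {y : EuclideanSpace ℝ (Fin n)}
    (hy : y ∉ interior Δ) :
    ∃ v : EuclideanSpace ℝ (Fin n), ‖v‖ = 1 ∧ ∀ a ∈ Δ, inner ℝ v a ≤ inner ℝ v y := by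
  obtain ⟨f, hf⟩ := geometric_hahn_banach_open_point hΔ.1.interior isOpen_interior hy
  let w := (InnerProductSpace.toDual ℝ (EuclideanSpace ℝ (Fin n))).symm f
  have hw : ∀ a, inner ℝ w a = f a := fun a => InnerProductSpace.toDual_symm_apply
  have hw0 : w ≠ 0 := by
    intro h0
    obtain ⟨a, ha⟩ := hdim
    have := hf a ha
    rw [← hw, ← hw, h0] at this
    simp at this
  refine ⟨‖w‖⁻¹ • w, by simp [norm_smul, hw0], fun a ha => ?_⟩
  rw [real_inner_smul_left, real_inner_smul_left]
  refine mul_le_mul_of_nonneg_left ?_ (by positivity)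
  have hcl : a ∈ closure (interior Δ) := by
    rw [hΔ.1.closure_interior_eq_closure_of_nonempty_interior hdim]
    exact subset_closure ha
  rw [hw, hw]
  exact closure_minimal (fun b hb => (hf b hb).le)
    (isClosed_le f.continuous continuous_const) hcl

/-- In a convex body with interior point `x + u`, the line in direction `u` near a non-interior
point `x` starts at a non-interior point close to `x`, and stays in the body for a uniform time. -/
lemma IsConvexBody.exists_lower_boundary {k : ℕ} {Δ : Set (EuclideanSpace ℝ (Fin (k + 1)))}
    (hΔ : IsConvexBody Δ) {x u : EuclideanSpace ℝ (Fin (k + 1))} (hxΔ : x ∈ Δ)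
    (hx : x ∉ interior Δ) (hxu : x + u ∈ interior Δ)
    {T : (ℝ × (Fin k → ℝ)) ≃L[ℝ] EuclideanSpace ℝ (Fin (k + 1))} (hT : T (1, 0) = u)
    {δ : ℝ} (hδ : 0 < δ) :
    ∃ U : Set (Fin k → ℝ), IsOpen U ∧ U.Nonempty ∧ ∀ z ∈ U, ∃ τ : ℝ, T (τ, z) ∈ Δ ∧
      T (τ, z) ∉ interior Δ ∧ dist (T (τ, z)) x ≤ δ ∧
      ∀ s ∈ Set.Icc (0 : ℝ) (1 / 2), T (τ, z) + s • u ∈ Δ := by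
  have hTadd : ∀ (t s : ℝ) (z : Fin k → ℝ), T (t + s, z) = T (t, z) + s • u := by
    intro t s z
    rw [← hT, ← map_smul, ← map_add]
    simp
  obtain ⟨⟨t₀, z₀⟩, hx0⟩ := T.surjective x
  have hcont : Continuous fun w : ℝ × (Fin k → ℝ) => T (t₀ + w.1, w.2) := by fun_prop
  have hnear : ∀ᶠ w : ℝ × (Fin k → ℝ) in nhds 0 ×ˢ nhds z₀,
      dist (T (t₀ + w.1, w.2)) x < δ := by
    rw [← nhds_prod_eq]
    have : Filter.Tendsto (fun w : ℝ × (Fin k → ℝ) => T (t₀ + w.1, w.2)) (nhds (0, z₀))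
        (nhds x) := by
      have := hcont.tendsto (0, z₀)
      simpa [hx0] using this
    exact this.eventually (Metric.ball_mem_nhds x hδ)
  obtain ⟨P, hP, Q, hQ, hPQ⟩ := Filter.eventually_prod_iff.1 hnear
  obtain ⟨σ, hσ, hσP⟩ := Metric.eventually_nhds_iff.1 hP
  let s := min (σ / 2) (1 / 2)
  have hs : 0 < s := by positivity
  have hs2 : s ≤ 1 / 2 := min_le_right _ _
  have hsσ : s < σ := lt_of_le_of_lt (min_le_left _ _) (by linarith)
  have hlow : T (t₀ - s, z₀) ∉ Δ := by
    intro hmem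
    apply hx
    have h1 : T (t₀ - s, z₀) = x + (-s) • u := by
      rw [sub_eq_add_neg, hTadd, hx0]
    rw [h1] at hmem
    have h2 := hΔ.1.openSegment_interior_self_subset_interior hxu hmem
    apply h2
    refine ⟨s / (1 + s), 1 / (1 + s), by positivity, by positivity, by field_simp; ring, ?_⟩
    rw [smul_add, smul_add, smul_smul]
    have : s / (1 + s) + 1 / (1 + s) = 1 := by field_simp; ring
    have h3 : 1 / (1 + s) * -s = -(s / (1 + s)) := by ring
    rw [h3, neg_smul]
    calc _ = (s / (1 + s) + 1 / (1 + s)) • x := by module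
      _ = x := by rw [this, one_smul]
  have hmid : T (t₀ + s, z₀) ∈ interior Δ := by
    rw [hTadd, hx0]
    have := hΔ.1.add_smul_mem_interior hxΔ hxu (t := s) ⟨hs, by linarith⟩
    exact this
  have hhigh : T (t₀ + 1, z₀) ∈ interior Δ := by
    rw [hTadd, hx0, one_smul]; exact hxu
  have hTc : ∀ t : ℝ, Continuous fun z : Fin k → ℝ => T (t, z) := fun t => by fun_prop
  have hev : ∀ᶠ z in nhds z₀, T (t₀ - s, z) ∉ Δ ∧ T (t₀ + s, z) ∈ Δ ∧ T (t₀ + 1, z) ∈ Δ ∧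
      Q z := by
    refine ((hTc _).continuousAt.eventually_mem (hΔ.2.1.isClosed.isOpen_compl.mem_nhds hlow)).and
      (((hTc _).continuousAt.eventually_mem (mem_interior_iff_mem_nhds.1 hmid)).and
      (((hTc _).continuousAt.eventually_mem (mem_interior_iff_mem_nhds.1 hhigh)).and hQ))
  obtain ⟨U, hU, hUo, hzU⟩ := eventually_nhds_iff.1 hev
  refine ⟨U, hUo, ⟨z₀, hzU⟩, fun z hz => ?_⟩
  obtain ⟨h1, h2, h3, h4⟩ := hU z hz
  let J : Set ℝ := {t | T (t, z) ∈ Δ} ∩ Set.Icc (t₀ - s) (t₀ + s)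
  have hcontz : Continuous fun t : ℝ => T (t, z) := by fun_prop
  have hJ : IsCompact J := isCompact_Icc.inter_left (hΔ.2.1.isClosed.preimage hcontz)
  obtain ⟨τ, hτ, hmin⟩ := hJ.exists_isLeast ⟨t₀ + s, h2, by simp; linarith⟩
  have hτs : t₀ - s < τ := by
    refine lt_of_le_of_ne hτ.2.1 fun h => h1 ?_
    rw [h]; exact hτ.1
  refine ⟨τ, hτ.1, fun h_int => ?_, ?_, fun a ha => ?_⟩
  · have hev2 : ∀ᶠ t in nhds τ, T (t, z) ∈ Δ :=
      hcontz.continuousAt.eventually_mem (mem_interior_iff_mem_nhds.1 h_int)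
    obtain ⟨t, ⟨ht1, ht2⟩, ht3⟩ := (((hev2.and (eventually_gt_nhds hτs)).filter_mono
      nhdsWithin_le_nhds).and (self_mem_nhdsWithin (s := Set.Iio τ))).exists
    have := hmin (show t ∈ J from ⟨ht1, ht2.le, (le_of_lt ht3).trans hτ.2.2⟩)
    exact absurd ht3 (not_lt.2 this)
  · have := @hPQ (τ - t₀) (hσP (by
      rw [Real.dist_eq, sub_zero, abs_lt]
      constructor <;> linarith [hτ.2.2])) z h4
    simpa using this.le
  · have h5 : T (t₀ + 1, z) = T (τ, z) + (t₀ + 1 - τ) • u := by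
      rw [← hTadd]; congr 2; ring
    have hden : 1 / 2 ≤ t₀ + 1 - τ := by linarith [hτ.2.2]
    rw [h5] at h3
    have := hΔ.1.add_smul_mem hτ.1 h3 (t := a / (t₀ + 1 - τ))
      ⟨div_nonneg ha.1 (by linarith), (div_le_one (by linarith)).2 (ha.2.trans hden)⟩
    rwa [smul_smul, div_mul_cancel₀ _ (by linarith)] at this

/-- Cutting off a cap at a strict point yields a convex body with the same projection along `u`
whose mixed volume with `Δ` is strictly smaller, in the sense of first order volume growth. -/
lemma IsStrictPoint.exists_volume_gap {k : ℕ} {Δ : Set (EuclideanSpace ℝ (Fin (k + 1)))}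
    (hΔ : IsConvexBody Δ) {x u : EuclideanSpace ℝ (Fin (k + 1))} (hx : IsStrictPoint Δ x)
    (hxu : x + u ∈ interior Δ) (hu : u ≠ 0)
    {T : (ℝ × (Fin k → ℝ)) ≃L[ℝ] EuclideanSpace ℝ (Fin (k + 1))} {c : ENNReal}
    (hc : c ≠ 0) (hT : T (1, 0) = u)
    (hvol : ∀ A : Set (EuclideanSpace ℝ (Fin (k + 1))),
        MeasurableSet A → volume A = c * ∫⁻ z, volume {t : ℝ | T (t, z) ∈ A}) :
    ∃ K : Set (EuclideanSpace ℝ (Fin (k + 1))), IsConvexBody K ∧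
      (fun w => (T.symm w).2) '' K = (fun w => (T.symm w).2) '' Δ ∧
      ∃ c₀ > 0, ∀ ε > 0, (volume (Δ + ε • K)).toReal + c₀ * ε ≤
        (1 + ε) ^ (k + 1) * (volume Δ).toReal := by
  have hxΔ : x ∈ Δ := hΔ.2.1.isClosed.frontier_subset hx.1
  have hun : 0 < ‖u‖ := norm_pos_iff.2 hu
  obtain ⟨R, hR, hRΔ⟩ := Metric.mem_nhds_iff.1 (mem_interior_iff_mem_nhds.1 hxu)
  let ρ := min R (‖u‖ / 2)
  have hρ : 0 < ρ := by positivity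
  have hρR : ρ ≤ R := min_le_left _ _
  have hρu : ρ ≤ ‖u‖ / 2 := min_le_right _ _
  have hshift : ∀ w ∈ Metric.ball x ρ, w + u ∈ Δ \ Metric.ball x ρ := by
    intro w hw
    rw [Metric.mem_ball, dist_eq_norm] at hw
    refine ⟨hRΔ ?_, ?_⟩
    · rw [Metric.mem_ball, dist_eq_norm, add_sub_add_right_eq_sub]
      exact hw.trans_le hρR
    · rw [Metric.mem_ball, dist_eq_norm, not_lt]
      have : ‖u‖ ≤ ‖w + u - x‖ + ‖w - x‖ := by
        calc ‖u‖ = ‖(w + u - x) - (w - x)‖ := by congr 1; abel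
          _ ≤ _ := norm_sub_le _ _
      linarith
  obtain ⟨δ, hδ, hgap⟩ := hx.exists_support_gap hΔ hρ
  obtain ⟨U, hUo, hUne, hU⟩ := hΔ.exists_lower_boundary hxΔ hx.1.2 hxu hT hδ
  let K := closedConvexHull ℝ (Δ \ Metric.ball x ρ)
  have hKΔ : K ⊆ Δ := closedConvexHull_min Set.sdiff_subset hΔ.1 hΔ.2.1.isClosed
  have hK : IsConvexBody K :=
    ⟨convex_closedConvexHull, hΔ.2.1.of_isClosed_subset isClosed_closedConvexHull hKΔ,
      ⟨x + u, subset_closedConvexHull (hshift x (Metric.mem_ball_self hρ))⟩⟩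
  refine ⟨K, hK, (Set.image_mono hKΔ).antisymm ?_, ?_⟩
  · rintro _ ⟨w, hw, rfl⟩
    by_cases hwb : w ∈ Metric.ball x ρ
    · refine ⟨w + u, subset_closedConvexHull (hshift w hwb), ?_⟩
      simp [← hT]
    · exact ⟨w, subset_closedConvexHull ⟨hw, hwb⟩, rfl⟩
  have hgapK : ∀ v y q : EuclideanSpace ℝ (Fin (k + 1)), ‖v‖ = 1 → y ∈ Δ →
      (∀ a ∈ Δ, inner ℝ v a ≤ inner ℝ v y) → dist y x ≤ δ → q ∈ K →
      inner ℝ v q + δ ≤ inner ℝ v y := by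
    intro v y q hv hy hs hd hq
    have hconv : Convex ℝ {q : EuclideanSpace ℝ (Fin (k + 1)) | inner ℝ v q ≤ inner ℝ v y - δ} :=
      convex_halfSpace_le (innerSL ℝ v).toLinearMap.isLinear _
    have := closedConvexHull_min (t := {q | inner ℝ v q ≤ inner ℝ v y - δ})
      (fun q hq => by
        have := hgap v y q hv hy hs hd hq
        rw [Set.mem_ofPred_eq]; linarith) hconv
      (isClosed_le (by fun_prop) continuous_const) hq
    rw [Set.mem_ofPred_eq] at this
    linarith
  let s' := min (1 / 2) (δ / ‖u‖)
  have hs' : 0 < s' := by positivity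
  have hs'2 : s' ≤ 1 / 2 := min_le_left _ _
  have hs'u : s' * ‖u‖ ≤ δ := by
    have : s' ≤ δ / ‖u‖ := min_le_right _ _
    rwa [le_div_iff₀ hun] at this
  have hTadd : ∀ (t s : ℝ) (z : Fin k → ℝ), T (t + s, z) = T (t, z) + s • u := by
    intro t s z
    rw [← hT, ← map_smul, ← map_add]
    simp
  have hfin : ∀ A : Set (EuclideanSpace ℝ (Fin (k + 1))), IsConvexBody A → volume A ≠ ⊤ :=
    fun A hA => hA.2.1.measure_lt_top.ne
  have hcol : ∀ ε > 0, ∀ z ∈ U, ENNReal.ofReal (ε * s') ≤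
      volume {t : ℝ | T (t, (1 + ε) • z) ∈ ((1 + ε) • Δ) \ (Δ + ε • K)} := by
    intro ε hε z hz
    obtain ⟨τ, hτ, hτi, hτd, hτs⟩ := hU z hz
    obtain ⟨v, hv, hvs⟩ := hΔ.exists_unit_normal ⟨_, hxu⟩ hτi
    have hsub : Set.Ico ((1 + ε) * τ) ((1 + ε) * τ + ε * s') ⊆
        {t : ℝ | T (t, (1 + ε) • z) ∈ ((1 + ε) • Δ) \ (Δ + ε • K)} := by
      intro t ht
      obtain ⟨a, rfl⟩ : ∃ a, t = (1 + ε) * τ + ε * a := ⟨(t - (1 + ε) * τ) / ε, by field_simp; ring⟩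
      have ha0 : 0 ≤ a := by
        have := ht.1
        by_contra! h
        nlinarith [mul_neg_of_pos_of_neg hε h]
      have ha1 : a < s' := by
        have := ht.2
        exact lt_of_mul_lt_mul_left (by linarith) hε.le
      have hpt : T ((1 + ε) * τ + ε * a, (1 + ε) • z) =
          (1 + ε) • T (τ, z) + (ε * a) • u := by
        rw [hTadd, ← map_smul]; simp
      rw [Set.mem_ofPred_eq, hpt]
      constructor
      · have := hτs (ε * a / (1 + ε)) ⟨by positivity, by
          rw [div_le_iff₀ (by positivity)]
          nlinarith⟩
        refine ⟨_, this, ?_⟩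
        simp only [smul_add, smul_smul]
        congr 2
        field_simp
      · rintro ⟨y, hy, _, ⟨q, hq, rfl⟩, hyq⟩
        have e := congrArg (fun w => inner ℝ v w) hyq
        simp only [inner_add_right, inner_smul_right] at e
        have h1 := hvs y hy
        have h2 := hgapK v _ q hv hτ hvs hτd hq
        have h3 : -‖u‖ ≤ inner ℝ v u := by
          have := abs_real_inner_le_norm v u
          rw [hv, one_mul] at this
          exact (abs_le.1 this).1
        have h4 : a * ‖u‖ < δ := lt_of_lt_of_le (by gcongr) hs'u
        have h5 : -δ < a * inner ℝ v u := by nlinarith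
        have h6 : ε * inner ℝ v q + ε * δ ≤ ε * inner ℝ v (T (τ, z)) := by
          rw [← mul_add]; gcongr
        have h7 : ε * (-δ) < ε * (a * inner ℝ v u) := by gcongr
        nlinarith
    refine le_trans ?_ (measure_mono hsub)
    rw [Real.volume_Ico]
    simp
  have hUpos : 0 < volume U := hUo.measure_pos _ hUne
  have hmain : ∀ ε > 0, volume (Δ + ε • K) + c * volume U * ENNReal.ofReal (ε * s') ≤
      volume ((1 + ε) • Δ) := by
    intro ε hε
    have hL : IsConvexBody (Δ + ε • K) := hΔ.add (hK.smul ε)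
    have hsub : Δ + ε • K ⊆ (1 + ε) • Δ := by
      rw [hΔ.1.add_smul zero_le_one hε.le, one_smul]
      exact Set.add_subset_add_left (Set.smul_set_mono hKΔ)
    have hmeas := ((hΔ.smul (1 + ε)).2.1.measurableSet.diff hL.2.1.measurableSet)
    rw [← measure_sdiff_add_inter (μ := volume) ((1 + ε) • Δ) hL.2.1.measurableSet,
      Set.inter_eq_self_of_subset_right hsub, add_comm, hvol _ hmeas, mul_assoc]
    gcongr
    calc volume U * ENNReal.ofReal (ε * s')
        ≤ volume ((1 + ε) • U) * ENNReal.ofReal (ε * s') := by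
          refine mul_le_mul_left ?_ _
          rw [Measure.addHaar_smul]
          refine le_mul_of_one_le_left (by simp) ?_
          rw [ENNReal.one_le_ofReal, abs_of_nonneg (by positivity)]
          exact one_le_pow₀ (by linarith)
      _ = ∫⁻ z in (1 + ε) • U, ENNReal.ofReal (ε * s') := by
          rw [setLIntegral_const, mul_comm]
      _ ≤ ∫⁻ z in (1 + ε) • U,
            volume {t : ℝ | T (t, z) ∈ ((1 + ε) • Δ) \ (Δ + ε • K)} := by
          refine setLIntegral_mono' (hUo.smul₀ (by positivity)).measurableSet ?_
          rintro _ ⟨z, hz, rfl⟩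
          exact hcol ε hε z hz
      _ ≤ _ := setLIntegral_le_lintegral _ _
  have hcU : c * volume U ≠ ⊤ := by
    intro h
    have := hmain 1 one_pos
    rw [h, ENNReal.top_mul (by simpa using hs'), add_top, top_le_iff] at this
    exact hfin _ (hΔ.smul (1 + 1)) this
  refine ⟨(c * volume U).toReal * s',
    mul_pos (ENNReal.toReal_pos (mul_ne_zero hc hUpos.ne') hcU) hs', fun ε hε => ?_⟩
  have h1 := ENNReal.toReal_mono (hfin _ (hΔ.smul (1 + ε))) (hmain ε hε)
  rw [ENNReal.toReal_add (hfin _ (hΔ.add (hK.smul ε)))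
    (ENNReal.mul_ne_top hcU ENNReal.ofReal_ne_top), ENNReal.toReal_mul (a := c * volume U),
    ENNReal.toReal_ofReal (by positivity), Measure.addHaar_smul,
    ENNReal.toReal_mul (b := volume Δ), ENNReal.toReal_ofReal (by positivity),
    abs_of_nonneg (by positivity)] at h1
  simp only [finrank_euclideanSpace, Fintype.card_fin] at h1
  linarith

/-- `t ↦ vol (Δ + t K)` is monotone. -/
lemma IsConvexBody.volume_add_smul_mono {n : ℕ} {Δ K : Set (EuclideanSpace ℝ (Fin n))}
    (hK : IsConvexBody K) {s t : ℝ} (hs : 0 ≤ s) (hst : s ≤ t) :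
    volume (Δ + s • K) ≤ volume (Δ + t • K) := by
  obtain ⟨q, hq⟩ := hK.2.2
  rw [← measure_vadd volume ((t - s) • q) (Δ + s • K)]
  refine measure_mono ?_
  rintro _ ⟨_, ⟨y, hy, _, ⟨q', hq', rfl⟩, rfl⟩, rfl⟩
  have ht : t = s + (t - s) := by ring
  rw [ht, hK.1.add_smul hs (by linarith)]
  refine ⟨y, hy, _, ⟨_, ⟨q', hq', rfl⟩, _, ⟨q, hq, rfl⟩, rfl⟩, ?_⟩
  simp only [vadd_eq_add, add_sub_cancel]
  abel

lemma IsConvexBody.sum {n : ℕ} {ι : Type*} {K : ι → Set (EuclideanSpace ℝ (Fin n))}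
    {S : Finset ι} (hK : ∀ j ∈ S, IsConvexBody (K j)) : IsConvexBody (∑ j ∈ S, K j) := by
  refine Finset.sum_induction K IsConvexBody (fun _ _ => IsConvexBody.add) ?_ hK
  exact ⟨convex_singleton 0, isCompact_singleton, Set.singleton_nonempty 0⟩

lemma LinearMap.image_finset_sum_eq_smul {ι E F : Type*} [AddCommGroup E] [Module ℝ E]
    [AddCommGroup F] [Module ℝ F] (P : E →ₗ[ℝ] F) {K : ι → Set E} {Q : Set F} (hQ : Convex ℝ Q)
    (hQne : Q.Nonempty) {a : ι → ℝ} {S : Finset ι} (ha : ∀ j ∈ S, 0 ≤ a j)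
    (hK : ∀ j ∈ S, P '' K j = a j • Q) : P '' (∑ j ∈ S, K j) = (∑ j ∈ S, a j) • Q := by
  classical
  induction S using Finset.induction_on with
  | empty => simp [Set.zero_smul_set hQne, ← Set.singleton_zero]
  | insert i S hi ih =>
    simp only [Finset.mem_insert, forall_eq_or_imp] at ha hK
    rw [Finset.sum_insert hi, Finset.sum_insert hi, Set.image_add, ih ha.2 hK.2, hK.1,
      hQ.add_smul ha.1 (Finset.sum_nonneg ha.2)]

/-- The mixed volume of a segment and bodies whose projections along it are homothetic. -/
lemma mixedVol_segment {k : ℕ} {u : EuclideanSpace ℝ (Fin (k + 1))}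
    {T : (ℝ × (Fin k → ℝ)) ≃L[ℝ] EuclideanSpace ℝ (Fin (k + 1))} {c : ENNReal}
    (hc : c ≠ ⊤) (hT : T (1, 0) = u)
    (hvol : ∀ A : Set (EuclideanSpace ℝ (Fin (k + 1))),
        MeasurableSet A → volume A = c * ∫⁻ z, volume {t : ℝ | T (t, z) ∈ A})
    {K : Fin (k + 1) → Set (EuclideanSpace ℝ (Fin (k + 1)))} {i : Fin (k + 1)}
    (hKi : K i = segment ℝ 0 u) {Q : Set (Fin k → ℝ)} (hQ : Convex ℝ Q) (hQne : Q.Nonempty)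
    {a : Fin (k + 1) → ℝ} (ha : ∀ j, j ≠ i → 0 ≤ a j) (hK : ∀ j, j ≠ i → IsConvexBody (K j))
    (hKQ : ∀ j, j ≠ i → (fun w => (T.symm w).2) '' K j = a j • Q) :
    mixedVol (k + 1) K = (((k + 1).factorial : ℝ))⁻¹ * (c.toReal * (volume Q).toReal *
      (k.factorial * ∏ j ∈ Finset.univ.erase i, a j)) := by
  let P : EuclideanSpace ℝ (Fin (k + 1)) →ₗ[ℝ] (Fin k → ℝ) :=
    LinearMap.snd ℝ ℝ (Fin k → ℝ) ∘ₗ T.symm.toLinearMap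
  have hcard : (Finset.univ.erase i).card = k := by
    simp [Finset.card_erase_of_mem (Finset.mem_univ i)]
  have hterm : ∀ S ∈ (Finset.univ.erase i).powerset,
      (volume (∑ j ∈ insert i S, K j)).toReal - (volume (∑ j ∈ S, K j)).toReal =
        c.toReal * (volume Q).toReal * (0 + ∑ j ∈ S, a j) ^ k := by
    intro S hS
    rw [Finset.mem_powerset] at hS
    have hS' : ∀ j ∈ S, j ≠ i := fun j hj => Finset.ne_of_mem_erase (hS hj)
    have hL : IsConvexBody (∑ j ∈ S, K j) := IsConvexBody.sum fun j hj => hK j (hS' j hj)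
    have hP : (fun w => (T.symm w).2) '' (∑ j ∈ S, K j) = (∑ j ∈ S, a j) • Q :=
      P.image_finset_sum_eq_smul hQ hQne (fun j hj => ha j (hS' j hj))
        (fun j hj => hKQ j (hS' j hj))
    have hPfin : volume ((∑ j ∈ S, a j) • Q) ≠ ⊤ := by
      rw [← hP]
      exact (hL.2.1.image (continuous_snd.comp T.symm.continuous)).measure_lt_top.ne
    have hnonneg : 0 ≤ ∑ j ∈ S, a j := Finset.sum_nonneg fun j hj => ha j (hS' j hj)
    rw [Finset.sum_insert (fun h => hS' i h rfl), hKi, add_comm (segment ℝ 0 u),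
      volume_add_segment hT hvol hL, hP,
      ENNReal.toReal_add hL.2.1.measure_lt_top.ne (ENNReal.mul_ne_top hc hPfin),
      add_sub_cancel_left, ENNReal.toReal_mul, Measure.addHaar_smul,
      ENNReal.toReal_mul, ENNReal.toReal_ofReal (by positivity), abs_of_nonneg (by positivity)]
    simp only [Module.finrank_fintype_fun_eq_card, Fintype.card_fin, zero_add]
    ring
  unfold mixedVol
  rw [sum_finset_fin_neg_one_pow_mul i, Finset.sum_congr rfl fun S hS => by rw [hterm S hS]]
  have hpol := sum_powerset_neg_one_pow_mul_add_sum_pow a (Finset.univ.erase i) k hcard.ge 0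
  rw [if_pos hcard.symm] at hpol
  congr 1
  rw [show (k.factorial : ℝ) = ((Finset.univ.erase i).card.factorial : ℝ) by rw [hcard], ← hpol,
    Finset.mul_sum]
  exact Finset.sum_congr rfl fun S _ => by ring

lemma IsConvexBody.sum_const_eq_smul {n : ℕ} {Δ : Set (EuclideanSpace ℝ (Fin n))}
    (hΔ : IsConvexBody Δ) {ι : Type*} (S : Finset ι) : ∑ _j ∈ S, Δ = (S.card : ℝ) • Δ := by
  have := (LinearMap.id (R := ℝ) (M := EuclideanSpace ℝ (Fin n))).image_finset_sum_eq_smul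
    (K := fun _ : ι => Δ) (a := fun _ => 1) (S := S) hΔ.1 hΔ.2.2 (by simp) (by simp)
  simpa using this

lemma toReal_volume_smul {n : ℕ} {s : ℝ} (hs : 0 ≤ s) (A : Set (EuclideanSpace ℝ (Fin n))) :
    (volume (s • A)).toReal = s ^ n * (volume A).toReal := by
  rw [Measure.addHaar_smul, ENNReal.toReal_mul, ENNReal.toReal_ofReal (by positivity),
    abs_of_nonneg (by positivity)]
  simp

/-- The mixed volume `V(Δ + εK, Δ, …, Δ)` in terms of the difference quotients of
`t ↦ vol (Δ + tK)`. -/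
lemma mixedVol_add_smul {k : ℕ} {Δ K : Set (EuclideanSpace ℝ (Fin (k + 1)))}
    (hΔ : IsConvexBody Δ) {ε : ℝ} (hε : 0 < ε) :
    mixedVol (k + 1) (fun j => if (j : ℕ) = 0 then Δ + ε • K else Δ) =
      (volume Δ).toReal + (((k + 1).factorial : ℝ))⁻¹ * (ε *
        ∑ S : Finset (Fin (k + 1)) with 0 ∈ S, (-1 : ℝ) ^ (k + 1 - S.card) * (S.card : ℝ) ^ k *
          (((volume (Δ + (ε / S.card) • K)).toReal - (volume Δ).toReal) / (ε / S.card))) := by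
  have hterm : ∀ S : Finset (Fin (k + 1)),
      (volume (∑ j ∈ S, if (j : ℕ) = 0 then Δ + ε • K else Δ)).toReal =
        (volume Δ).toReal * (0 + ∑ _j ∈ S, (1 : ℝ)) ^ (k + 1) + if 0 ∈ S then
          ε * ((S.card : ℝ) ^ k * (((volume (Δ + (ε / S.card) • K)).toReal -
            (volume Δ).toReal) / (ε / S.card))) else 0 := by
    intro S
    simp only [Finset.sum_const, nsmul_eq_mul, mul_one, zero_add]
    split_ifs with h0
    · have hpos : (0 : ℝ) < S.card := by exact_mod_cast Finset.card_pos.2 ⟨0, h0⟩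
      have hsum : (∑ j ∈ S, if (j : ℕ) = 0 then Δ + ε • K else Δ) =
          (S.card : ℝ) • (Δ + (ε / S.card) • K) := by
        rw [← Finset.add_sum_erase S _ h0]
        have : ∀ j ∈ S.erase 0, (if (j : ℕ) = 0 then Δ + ε • K else Δ) = Δ := by
          intro j hj
          rw [if_neg]
          have := Finset.ne_of_mem_erase hj
          exact fun h => this (Fin.ext h)
        rw [Finset.sum_congr rfl this]
        simp only [Fin.val_zero, if_true]
        rw [add_right_comm, Finset.add_sum_erase S (fun _ => Δ) h0, hΔ.sum_const_eq_smul,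
          smul_add, smul_smul, mul_div_cancel₀ _ hpos.ne']
      rw [hsum, toReal_volume_smul hpos.le]
      field_simp
      ring
    · have : ∀ j ∈ S, (if (j : ℕ) = 0 then Δ + ε • K else Δ) = Δ := by
        intro j hj
        rw [if_neg]
        exact fun h => h0 ((Fin.ext h : j = 0) ▸ hj)
      rw [Finset.sum_congr rfl this, hΔ.sum_const_eq_smul, toReal_volume_smul (by positivity)]
      ring
  have hpol := sum_powerset_neg_one_pow_mul_add_sum_pow (fun _ : Fin (k + 1) => (1 : ℝ))
    Finset.univ (k + 1) (by simp) 0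
  simp only [Finset.powerset_univ, Finset.card_univ, Fintype.card_fin, if_true,
    Finset.prod_const_one, mul_one] at hpol
  unfold mixedVol
  simp_rw [hterm, mul_add, Finset.sum_add_distrib, mul_left_comm _ (volume Δ).toReal,
    ← Finset.mul_sum, hpol, Finset.sum_filter, Finset.mul_sum]
  have hfac : ((k + 1).factorial : ℝ) ≠ 0 := by positivity
  rw [mul_comm (volume Δ).toReal, mul_add, ← mul_assoc, inv_mul_cancel₀ hfac, one_mul,
    Finset.mul_sum]
  congr 1
  refine Finset.sum_congr rfl fun S _ => ?_
  split_ifs <;> ring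

lemma mixedVol_const {k : ℕ} {Δ : Set (EuclideanSpace ℝ (Fin (k + 1)))} (hΔ : IsConvexBody Δ) :
    mixedVol (k + 1) (fun _ => Δ) = (volume Δ).toReal := by
  have h := mixedVol_add_smul (K := {0}) hΔ one_pos
  simpa using h

lemma sum_filter_mem_zero_neg_one_pow_mul_card_pow (k : ℕ) :
    ∑ S : Finset (Fin (k + 1)) with 0 ∈ S, (-1 : ℝ) ^ (k + 1 - S.card) * (S.card : ℝ) ^ k =
      k.factorial := by
  have h := sum_finset_fin_neg_one_pow_mul (0 : Fin (k + 1))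
    (fun S => if 0 ∈ S then (S.card : ℝ) ^ k else 0)
  have hcard : (Finset.univ.erase (0 : Fin (k + 1))).card = k := by
    simp [Finset.card_erase_of_mem]
  have hpol := sum_powerset_neg_one_pow_mul_add_sum_pow (fun _ : Fin (k + 1) => (1 : ℝ))
    (Finset.univ.erase 0) k hcard.ge 1
  rw [if_pos hcard.symm, Finset.prod_const_one, mul_one] at hpol
  rw [Finset.sum_filter]
  simp only [mul_ite, mul_zero] at h
  rw [h]
  conv_rhs => rw [← hcard, ← hpol]
  refine Finset.sum_congr rfl fun S hS => ?_
  rw [Finset.mem_powerset] at hS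
  have h0 : 0 ∉ S := fun h => Finset.notMem_erase _ _ (hS h)
  simp [h0, add_comm]

/-- If a combination of shifts of a function is bounded below, then so is, up to the total weight,
its asymptotic upper bound. -/
lemma le_sum_mul_of_le_sum_mul_shift {ι : Type*} (s : Finset ι) (w l : ι → ℝ) {Φ : ℝ → ℝ}
    (hΦ : ∀ a b : ℝ, IntervalIntegrable Φ volume a b) {A B M s₀ : ℝ} (hs₀ : 0 ≤ s₀)
    (hl : ∀ i ∈ s, 0 ≤ l i) (hM : ∀ x, 0 ≤ x → |Φ x| ≤ M) (hB : ∀ x, s₀ ≤ x → Φ x ≤ B)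
    (hW : 0 ≤ ∑ i ∈ s, w i) (hA : ∀ x, 0 ≤ x → A ≤ ∑ i ∈ s, w i * Φ (x + l i)) :
    A ≤ (∑ i ∈ s, w i) * B := by
  let C := ∑ i ∈ s, |w i| * (2 * M * l i)
  have key : ∀ X, 0 ≤ X → A * X ≤ (∑ i ∈ s, w i) * B * X + C := by
    intro X hX
    have hshift : ∀ a : ℝ, IntervalIntegrable (fun x => Φ (x + a)) volume s₀ (s₀ + X) := by
      intro a
      simpa using (hΦ (s₀ + a) (s₀ + X + a)).comp_add_right a
    have h_int : IntervalIntegrable (fun x => ∑ i ∈ s, w i * Φ (x + l i)) volume s₀ (s₀ + X) := by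
      have h := IntervalIntegrable.sum s (f := fun i x => w i * Φ (x + l i))
        fun i _ => (hshift (l i)).const_mul (a := s₀) (b := s₀ + X) (w i)
      have e : (fun x => ∑ i ∈ s, w i * Φ (x + l i)) =
          ∑ i ∈ s, fun x => w i * Φ (x + l i) := by
        ext x
        simp
      rw [e]
      exact h
    have h1 : A * X ≤ ∫ x in s₀..(s₀ + X), ∑ i ∈ s, w i * Φ (x + l i) := by
      have : ∫ _ in s₀..(s₀ + X), A = A * X := by simp [mul_comm]
      rw [← this]
      refine intervalIntegral.integral_mono_on (by linarith) (by simp) h_int ?_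
      intro x hx
      exact hA x (hs₀.trans hx.1)
    rw [intervalIntegral.integral_finsetSum fun i _ => (hshift (l i)).const_mul _] at h1
    have h2 : ∀ i ∈ s, ∫ x in s₀..(s₀ + X), w i * Φ (x + l i) ≤
        w i * (∫ x in s₀..(s₀ + X), Φ x) + |w i| * (2 * M * l i) := by
      intro i hi
      rw [intervalIntegral.integral_const_mul, intervalIntegral.integral_comp_add_right]
      have hli := hl i hi
      have h3 : (∫ x in (s₀ + l i)..(s₀ + X + l i), Φ x) - ∫ x in s₀..(s₀ + X), Φ x =
          (∫ x in (s₀ + X)..(s₀ + X + l i), Φ x) - ∫ x in s₀..(s₀ + l i), Φ x := by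
        rw [← intervalIntegral.integral_add_adjacent_intervals (hΦ s₀ (s₀ + l i))
          (hΦ (s₀ + l i) (s₀ + X)) , ← intervalIntegral.integral_add_adjacent_intervals
          (hΦ (s₀ + l i) (s₀ + X)) (hΦ (s₀ + X) (s₀ + X + l i))]
        ring
      have hb : ∀ p, 0 ≤ p → |∫ x in p..(p + l i), Φ x| ≤ M * l i := by
        intro p hp
        have := intervalIntegral.norm_integral_le_of_norm_le_const (f := Φ) (a := p)
          (b := p + l i) (C := M) (by
            intro x hx
            rw [Set.uIoc_of_le (by linarith)] at hx
            exact hM x (by linarith [hx.1]))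
        rwa [add_sub_cancel_left, abs_of_nonneg hli] at this
      have h4 := hb (s₀ + X) (by linarith)
      have h5 := hb s₀ hs₀
      have h6 : |(∫ x in (s₀ + l i)..(s₀ + X + l i), Φ x) - ∫ x in s₀..(s₀ + X), Φ x| ≤
          2 * M * l i := by
        rw [h3]
        refine (abs_sub _ _).trans ?_
        linarith
      have h7 := (le_abs_self (w i * ((∫ x in (s₀ + l i)..(s₀ + X + l i), Φ x) -
        ∫ x in s₀..(s₀ + X), Φ x))).trans_eq (abs_mul _ _)
      have h8 := mul_le_mul_of_nonneg_left h6 (abs_nonneg (w i))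
      linarith
    have h9 := h1.trans (Finset.sum_le_sum h2)
    rw [Finset.sum_add_distrib, ← Finset.sum_mul] at h9
    have h10 : ∫ x in s₀..(s₀ + X), Φ x ≤ B * X := by
      have : ∫ _ in s₀..(s₀ + X), B = B * X := by simp [mul_comm]
      rw [← this]
      exact intervalIntegral.integral_mono_on (by linarith) (hΦ _ _) (by simp)
        fun x hx => hB x hx.1
    have h11 := mul_le_mul_of_nonneg_left h10 hW
    linarith
  by_contra! hlt
  have hC : 0 ≤ C := by
    have := key 0 le_rfl
    simpa using this
  have hd : 0 < A - (∑ i ∈ s, w i) * B := sub_pos.2 hlt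
  have h := key ((C + 1) / (A - (∑ i ∈ s, w i) * B)) (by positivity)
  have h' : (A - (∑ i ∈ s, w i) * B) * ((C + 1) / (A - (∑ i ∈ s, w i) * B)) = C + 1 := by
    field_simp
  linarith

/-- The averaging step: a body `K` with a first order volume gap violates a uniform lower bound on
the mixed volumes `V(Δ + εK, Δ, …, Δ)`. -/
lemma exists_mixedVol_add_smul_lt {k : ℕ} {Δ K : Set (EuclideanSpace ℝ (Fin (k + 1)))}
    (hΔ : IsConvexBody Δ) (hK : IsConvexBody K) {c₀ : ℝ} (hc₀ : 0 < c₀)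
    (hgap : ∀ ε > 0, (volume (Δ + ε • K)).toReal + c₀ * ε ≤
        (1 + ε) ^ (k + 1) * (volume Δ).toReal) :
    ∃ ε > 0, mixedVol (k + 1) (fun j => if (j : ℕ) = 0 then Δ + ε • K else Δ) <
      (1 + ε) * (volume Δ).toReal := by
  by_contra! hcon
  set V := (volume Δ).toReal with hV
  have hV0 : 0 ≤ V := ENNReal.toReal_nonneg
  let F : ℝ → ℝ := fun t => (volume (Δ + t • K)).toReal
  let h : ℝ → ℝ := fun t => ∑ i ∈ Finset.range (k + 1), (1 + t) ^ i
  have hmono : ∀ {s t : ℝ}, 0 ≤ s → s ≤ t → F s ≤ F t := fun hs hst =>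
    ENNReal.toReal_mono (hΔ.add (hK.smul _)).2.1.measure_lt_top.ne
      (hK.volume_add_smul_mono hs hst)
  have hF0 : ∀ t, 0 ≤ t → V ≤ F t := by
    intro t ht
    have := hmono le_rfl ht
    simpa [F, Set.zero_smul_set hK.2.2] using this
  have hupper : ∀ t, 0 < t → (F t - V) / t ≤ h t * V - c₀ := by
    intro t ht
    rw [div_le_iff₀ ht]
    have h1 := hgap t ht
    have h2 := geom_sum_mul (1 + t) (k + 1)
    rw [add_sub_cancel_left] at h2
    calc F t - V ≤ ((1 + t) ^ (k + 1) - 1) * V - c₀ * t := by linarith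
      _ = _ := by rw [← h2]; ring
  have hlower : ∀ t, 0 < t → 0 ≤ (F t - V) / t := fun t ht =>
    div_nonneg (sub_nonneg.2 (hF0 t ht.le)) ht.le
  let Φ : ℝ → ℝ := fun x => (F (Real.exp (-x)) - V) / Real.exp (-x)
  have h_int : ∀ a b : ℝ, IntervalIntegrable Φ volume a b := by
    intro a b
    have h1 : Antitone fun x => F (Real.exp (-x)) := fun x y hxy =>
      hmono (Real.exp_pos _).le (Real.exp_le_exp.2 (neg_le_neg hxy))
    have h2 : IntervalIntegrable (fun x => F (Real.exp (-x)) - V) volume a b :=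
      h1.intervalIntegrable.sub (by simp)
    have h3 : ContinuousOn (fun x => (Real.exp (-x))⁻¹) (Set.uIcc a b) :=
      (Continuous.inv₀ (by fun_prop) fun x => (Real.exp_pos _).ne').continuousOn
    simpa only [Φ, div_eq_mul_inv] using h2.mul_continuousOn h3
  have hev : ∀ᶠ x in Filter.atTop, h (Real.exp (-x)) * V < (k + 1) * V + c₀ / 2 := by
    have hcont : Continuous fun t => h t * V := by fun_prop
    have h1 := (hcont.tendsto 0).comp Real.tendsto_exp_neg_atTop_nhds_zero
    refine h1.eventually_lt_const ?_
    simp only [h, add_zero, one_pow, Finset.sum_const, Finset.card_range, nsmul_eq_mul, mul_one]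
    push_cast
    linarith
  obtain ⟨s₁, hs₁⟩ := Filter.eventually_atTop.1 hev
  have hmain := le_sum_mul_of_le_sum_mul_shift
    (Finset.univ.filter fun S : Finset (Fin (k + 1)) => 0 ∈ S)
    (fun S => (-1 : ℝ) ^ (k + 1 - S.card) * (S.card : ℝ) ^ k) (fun S => Real.log S.card)
    h_int (A := (k + 1).factorial * V) (B := (k + 1) * V - c₀ / 2) (M := h 1 * V)
    (s₀ := max s₁ 0) (le_max_right _ _) (fun S _ => Real.log_natCast_nonneg _) ?_ ?_ ?_ ?_
  · rw [sum_filter_mem_zero_neg_one_pow_mul_card_pow, Nat.factorial_succ] at hmain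
    have hk : (0 : ℝ) < k.factorial := by positivity
    have : 0 < (k.factorial : ℝ) * c₀ := by positivity
    push_cast at hmain
    nlinarith
  · intro x hx
    have hp := Real.exp_pos (-x)
    rw [abs_of_nonneg (hlower _ hp)]
    refine (hupper _ hp).trans ?_
    have h1 : h (Real.exp (-x)) ≤ h 1 := by
      refine Finset.sum_le_sum fun i _ => ?_
      have : Real.exp (-x) ≤ 1 := Real.exp_le_one_iff.2 (by linarith)
      gcongr
    have := mul_le_mul_of_nonneg_right h1 hV0
    linarith
  · intro x hx
    have h1 := hs₁ x ((le_max_left _ _).trans hx)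
    have h2 := hupper _ (Real.exp_pos (-x))
    simp only [Φ]
    linarith
  · rw [sum_filter_mem_zero_neg_one_pow_mul_card_pow]
    positivity
  · intro x _
    have hp := Real.exp_pos (-x)
    have h1 := hcon _ hp
    rw [mixedVol_add_smul hΔ hp, add_mul, one_mul, add_le_add_iff_left, mul_left_comm,
      mul_le_mul_iff_right₀ hp, le_inv_mul_iff₀ (by positivity)] at h1
    refine h1.trans_eq (Finset.sum_congr rfl fun S hS => ?_)
    have hS0 : 0 ∈ S := (Finset.mem_filter.1 hS).2
    have hpos : (0 : ℝ) < S.card := by exact_mod_cast Finset.card_pos.2 ⟨0, hS0⟩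
    have hexp : Real.exp (-(x + Real.log S.card)) = Real.exp (-x) / S.card := by
      rw [neg_add, ← sub_eq_add_neg, Real.exp_sub, Real.exp_log hpos]
    simp only [Φ, F, hexp, hV]

/-- If an `n`-dimensional convex body `Δ` in `ℝⁿ` satisfies the Bezout inequality
`V(K₁,…,K_r,Δ[n-r]) V_n(Δ)^{r-1} ≤ ∏ᵢ V(Kᵢ,Δ[n-1])` for all convex bodies `K₁,…,K_r`,
then the boundary of `Δ` contains no strict points. -/
theorem no_strict_points_of_bezout (n r : ℕ) (hr2 : 2 ≤ r) (hrn : r ≤ n)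
    (Δ : Set (EuclideanSpace ℝ (Fin n))) (hΔ : IsConvexBody Δ)
    (hdim : (interior Δ).Nonempty)
    (hBezout : ∀ K : Fin r → Set (EuclideanSpace ℝ (Fin n)), (∀ i, IsConvexBody (K i)) →
      mixedVol n (fun j : Fin n => if h : (j : ℕ) < r then K ⟨(j : ℕ), h⟩ else Δ) *
          (mixedVol n (fun _ => Δ)) ^ (r - 1) ≤
        ∏ i : Fin r, mixedVol n (fun j : Fin n => if (j : ℕ) = 0 then K i else Δ)) :
    ∀ x : EuclideanSpace ℝ (Fin n), ¬ IsStrictPoint Δ x := by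
  intro x hx
  obtain ⟨k, rfl⟩ : ∃ k, n = k + 1 := ⟨n - 1, by omega⟩
  obtain ⟨m, rfl⟩ : ∃ m, r = m + 2 := ⟨r - 2, by omega⟩
  obtain ⟨p, hp⟩ := hdim
  obtain ⟨u, rfl⟩ : ∃ u, p = x + u := ⟨p - x, by abel⟩
  have hu : u ≠ 0 := by
    rintro rfl
    exact hx.1.2 (by simpa using hp)
  obtain ⟨T, c, hc0, hc, hT, hvol⟩ := exists_equiv_volume_eq_lintegral_columns u hu
  obtain ⟨K, hK, hKQ, c₀, hc₀, hgap⟩ := hx.exists_volume_gap hΔ hp hu hc0 hT hvol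
  obtain ⟨ε, hε, hlt⟩ := exists_mixedVol_add_smul_lt hΔ hK hc₀ hgap
  have hV : 0 < (volume Δ).toReal :=
    ENNReal.toReal_pos (Measure.measure_pos_of_nonempty_interior _ ⟨_, hp⟩).ne'
      hΔ.2.1.measure_lt_top.ne
  let P : EuclideanSpace ℝ (Fin (k + 1)) →ₗ[ℝ] (Fin k → ℝ) :=
    LinearMap.snd ℝ ℝ (Fin k → ℝ) ∘ₗ T.symm.toLinearMap
  let Q : Set (Fin k → ℝ) := (fun w => (T.symm w).2) '' Δ
  have hQ : Convex ℝ Q := hΔ.1.linear_image P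
  have hQne : Q.Nonempty := hΔ.2.2.image _
  have hQvol : 0 < (volume Q).toReal := by
    refine ENNReal.toReal_pos (Measure.measure_pos_of_nonempty_interior _ ?_).ne'
      (hΔ.2.1.image (continuous_snd.comp T.symm.continuous)).measure_lt_top.ne
    have hopen : IsOpenMap fun w => (T.symm w).2 :=
      isOpenMap_snd.comp T.symm.toHomeomorph.isOpenMap
    exact ⟨_, hopen.image_interior_subset Δ ⟨_, hp, rfl⟩⟩
  have hQL : (fun w => (T.symm w).2) '' (Δ + ε • K) = (1 + ε) • Q := by
    rw [hQ.add_smul zero_le_one hε.le, one_smul]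
    change P '' (Δ + ε • K) = P '' Δ + ε • (P '' Δ)
    have : P '' K = P '' Δ := hKQ
    rw [Set.image_add, image_smul_set, this]
  have hI : IsConvexBody (segment ℝ 0 u) := by
    refine ⟨convex_segment _ _, ?_, ⟨0, left_mem_segment ℝ 0 u⟩⟩
    rw [segment_eq_image_lineMap]
    exact isCompact_Icc.image AffineMap.lineMap_continuous
  have hL : IsConvexBody (Δ + ε • K) := hΔ.add (hK.smul ε)
  let G : ℝ := (((k + 1).factorial : ℝ))⁻¹ * (c.toReal * (volume Q).toReal * k.factorial)
  have hG : 0 < G := by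
    have := ENNReal.toReal_pos hc0 hc
    positivity
  have hmI : mixedVol (k + 1) (fun j => if (j : ℕ) = 0 then segment ℝ 0 u else Δ) = G := by
    have hne : ∀ j : Fin (k + 1), j ≠ 0 → (j : ℕ) ≠ 0 := fun j hj h => hj (Fin.ext h)
    rw [mixedVol_segment hc hT hvol (i := 0) (Q := Q) (a := fun _ => 1) (by simp) hQ hQne
      (fun _ _ => zero_le_one) (fun j hj => by rwa [if_neg (hne j hj)])
      (fun j hj => by rw [if_neg (hne j hj), one_smul])]
    simp [G]
  let Kf : Fin (m + 2) → Set (EuclideanSpace ℝ (Fin (k + 1))) := fun i =>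
    if (i : ℕ) = 0 then Δ + ε • K else if (i : ℕ) = 1 then segment ℝ 0 u else Δ
  have hB := hBezout Kf fun i => by
    simp only [Kf]
    split_ifs
    exacts [hL, hI, hΔ]
  have hmLI : mixedVol (k + 1)
      (fun j => if h : (j : ℕ) < m + 2 then Kf ⟨(j : ℕ), h⟩ else Δ) = (1 + ε) * G := by
    have hfun : (fun j : Fin (k + 1) => if h : (j : ℕ) < m + 2 then Kf ⟨(j : ℕ), h⟩ else Δ) =
        fun j : Fin (k + 1) => if (j : ℕ) = 0 then Δ + ε • K else
          if (j : ℕ) = 1 then segment ℝ 0 u else Δ := by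
      ext1 j
      simp only [Kf]
      split_ifs <;> first | rfl | omega
    let i₁ : Fin (k + 1) := ⟨1, by omega⟩
    have hne : ∀ j : Fin (k + 1), j ≠ i₁ → (j : ℕ) ≠ 1 := fun j hj h => hj (Fin.ext h)
    have h0 : (0 : Fin (k + 1)) ∈ Finset.univ.erase i₁ := by
      simp [i₁, Fin.ext_iff]
    rw [hfun, mixedVol_segment hc hT hvol (i := i₁) (Q := Q)
      (a := fun j => if j = 0 then 1 + ε else 1) (by simp [i₁]) hQ hQne
      (fun j _ => by positivity) (fun j hj => ?_) (fun j hj => ?_)]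
    · rw [Finset.prod_ite_eq' _ _ (fun _ => 1 + ε), if_pos h0]
      simp only [G]
      ring
    · simp only [if_neg (hne j hj)]
      split_ifs
      exacts [hL, hΔ]
    · simp only [if_neg (hne j hj)]
      by_cases hj0 : j = 0
      · simp [hj0, hQL]
      · have hj0' : (j : ℕ) ≠ 0 := fun h => hj0 (Fin.ext h)
        rw [if_neg hj0', if_neg hj0, one_smul]
  rw [hmLI, mixedVol_const hΔ, Fin.prod_univ_succ, Fin.prod_univ_succ] at hB
  have hrest : ∀ i : Fin m, mixedVol (k + 1)
      (fun j => if (j : ℕ) = 0 then Kf i.succ.succ else Δ) = (volume Δ).toReal := by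
    intro i
    rw [← mixedVol_const hΔ]
    simp [Kf]
  have hK0 : Kf 0 = Δ + ε • K := by simp [Kf]
  have hK1 : Kf (Fin.succ 0) = segment ℝ 0 u := by simp [Kf]
  simp only [hrest, hK0, hK1, hmI, Finset.prod_const, Finset.card_univ, Fintype.card_fin] at hB
  rw [show m + 2 - 1 = m + 1 by omega, pow_succ] at hB
  have hpos : 0 < G * (volume Δ).toReal ^ m := by positivity
  have := mul_lt_mul_of_pos_right hlt hpos
  linarith
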